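/- Let N ≥ 1 and let v ∈ C_c^∞(ℝ^N). Let (ε_n) be a sequence in (0,1] with ε_n → 0, and for each n let μ_n⁻ be a Borel probability measure on [0,1] whose support is contained in [0,ε_n]. Then lim_{n→∞} ∫_{[0,ε_n]} ‖(−Δ)^s v − v‖_{L²(ℝ^N)} dμ_n⁻(s) = 0. -/

import Mathlib

open MeasureTheory Filter Topology
open scoped ENNReal

noncomputable def cNs (N : ℕ) (s : ℝ) : ℝ :=
  (2 ^ (2 * s - 1) * Real.Gamma ((N + 2 * s) / 2) * (s * (1 - s))) /
    (Real.pi ^ ((N : ℝ) / 2) * Real.Gamma (2 - s))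

/-- The fractional Laplacian `(-Δ)^s u (x)`, with the convention `(-Δ)^0 u = u`. -/
noncomputable def fracLap0 (N : ℕ) (s : ℝ) (u : EuclideanSpace ℝ (Fin N) → ℝ)
    (x : EuclideanSpace ℝ (Fin N)) : ℝ :=
  if s = 0 then u x
  else cNs N s * ∫ y, (2 * u x - u (x + y) - u (x - y)) / ‖y‖ ^ ((N : ℝ) + 2 * s)

/-- The radial tail `r ↦ r ^ (-(N + 2s))` of the fractional kernel, cut off to `r > 1`. -/
noncomputable def kernelTail (N : ℕ) (s : ℝ) : ℝ → ℝ :=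
  (Set.Ioi 1).indicator fun r => r ^ (-((N : ℝ) + 2 * s))

/-- The radial singularity `r ↦ r ^ (1 / 2 - N)`, cut off to `r ≤ 1`. -/
noncomputable def kernelNear (N : ℕ) : ℝ → ℝ :=
  (Set.Iic 1).indicator fun r => r ^ (1 / 2 - (N : ℝ))

/-- The decay weight `(1 + ‖x‖) ^ (-N)`. -/
noncomputable def decayWeight (N : ℕ) (x : EuclideanSpace ℝ (Fin N)) : ℝ :=
  ((1 + ‖x‖) ^ N)⁻¹

lemma decayWeight_nonneg (N : ℕ) (x : EuclideanSpace ℝ (Fin N)) : 0 ≤ decayWeight N x := by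
  unfold decayWeight; positivity

lemma memLp_decayWeight {N : ℕ} (hN : 1 ≤ N) : MemLp (decayWeight N) 2 volume := by
  have hmeas : AEStronglyMeasurable (decayWeight N) volume := by
    apply Measurable.aestronglyMeasurable
    unfold decayWeight
    fun_prop
  rw [memLp_two_iff_integrable_sq hmeas]
  have h := integrable_one_add_norm (μ := (volume : Measure (EuclideanSpace ℝ (Fin N))))
    (r := 2 * N) (by
      have : (1 : ℝ) ≤ N := by exact_mod_cast hN
      rw [finrank_euclideanSpace_fin]; linarith)
  refine h.congr (Eventually.of_forall fun x => ?_)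
  have hx : 0 ≤ 1 + ‖x‖ := by positivity
  simp only [decayWeight]
  rw [Real.rpow_neg hx, show (2 * (N : ℝ)) = ((N * 2 : ℕ) : ℝ) by push_cast; ring,
    Real.rpow_natCast, pow_mul, inv_pow]

lemma pow_mul_kernelTail {N : ℕ} (hN : 1 ≤ N) (s : ℝ) :
    Set.EqOn (fun y : ℝ => y ^ (N - 1) • kernelTail N s y)
      ((Set.Ioi 1).indicator fun y => y ^ (-1 - 2 * s)) (Set.Ioi 0) := by
  intro y hy
  have hy : 0 < y := hy
  by_cases h1 : 1 < y
  · simp only [kernelTail, Set.mem_Ioi, h1, Set.indicator_of_mem, smul_eq_mul]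
    rw [← Real.rpow_natCast, ← Real.rpow_add hy, Nat.cast_sub hN]
    congr 1
    push_cast
    ring
  · simp [kernelTail, h1]

lemma integrable_kernelTail {N : ℕ} (hN : 1 ≤ N) {s : ℝ} (hs : 0 < s) :
    Integrable (fun y : EuclideanSpace ℝ (Fin N) => kernelTail N s ‖y‖) := by
  have : Nonempty (Fin N) := ⟨⟨0, hN⟩⟩
  rw [integrable_fun_norm_addHaar, finrank_euclideanSpace_fin,
    integrableOn_congr_fun (pow_mul_kernelTail hN s) measurableSet_Ioi]
  refine Integrable.integrableOn ?_
  rw [integrable_indicator_iff measurableSet_Ioi]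
  exact integrableOn_Ioi_rpow_of_lt (by linarith) one_pos

lemma integral_kernelTail {N : ℕ} (hN : 1 ≤ N) {s : ℝ} (hs : 0 < s) :
    ∫ y : EuclideanSpace ℝ (Fin N), kernelTail N s ‖y‖ =
      N * (Real.pi ^ ((N : ℝ) / 2) / Real.Gamma (N / 2 + 1)) / (2 * s) := by
  have : Nonempty (Fin N) := ⟨⟨0, hN⟩⟩
  have hI : ∫ y in Set.Ioi (0 : ℝ), y ^ (N - 1) • kernelTail N s y = 1 / (2 * s) := by
    rw [setIntegral_congr_fun measurableSet_Ioi (pow_mul_kernelTail hN s),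
      setIntegral_indicator measurableSet_Ioi,
      Set.inter_eq_right.2 (Set.Ioi_subset_Ioi zero_le_one),
      integral_Ioi_rpow_of_lt (by linarith) one_pos, Real.one_rpow,
      show -1 - 2 * s + 1 = -(2 * s) by ring, neg_div_neg_eq]
  have hV : (volume : Measure (EuclideanSpace ℝ (Fin N))).real (Metric.ball 0 1) =
      Real.pi ^ ((N : ℝ) / 2) / Real.Gamma (N / 2 + 1) := by
    have hG : 0 < Real.Gamma ((N : ℝ) / 2 + 1) := Real.Gamma_pos_of_pos (by positivity)
    rw [Measure.real, EuclideanSpace.volume_ball]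
    simp only [ENNReal.ofReal_one, one_pow, one_mul, Fintype.card_fin]
    rw [ENNReal.toReal_ofReal (by positivity), Real.sqrt_eq_rpow, ← Real.rpow_natCast,
      ← Real.rpow_mul Real.pi_pos.le]
    congr 2
    ring
  rw [integral_fun_norm_addHaar, finrank_euclideanSpace_fin, hI, hV, nsmul_eq_mul, smul_eq_mul]
  ring

lemma integrable_kernelNear {N : ℕ} (hN : 1 ≤ N) :
    Integrable (fun y : EuclideanSpace ℝ (Fin N) => kernelNear N ‖y‖) := by
  have h : IntegrableOn (fun y : EuclideanSpace ℝ (Fin N) => ‖y‖ ^ (1 / 2 - (N : ℝ)))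
      (Metric.ball 0 2) := by
    refine integrableOn_ball_of_norm_le_rpow (C := 1) (α := (N : ℝ) - 1 / 2)
      (by rwa [finrank_euclideanSpace_fin]) (by rw [finrank_euclideanSpace_fin]; linarith)
      (Eventually.of_forall fun y => ?_) (Measurable.aestronglyMeasurable (by fun_prop))
    rw [one_mul, neg_sub, Real.norm_of_nonneg (by positivity)]
  have h' := h.mono_set (Metric.closedBall_subset_ball (show (1 : ℝ) < 2 by norm_num))
  rw [← integrable_indicator_iff measurableSet_closedBall] at h'
  refine h'.congr (Eventually.of_forall fun y => ?_)
  by_cases hy : ‖y‖ ≤ 1 <;> simp [kernelNear, hy]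

/-- The factor multiplying `v x` produced by the tail of the fractional Laplacian. -/
noncomputable def tailFactor (N : ℕ) (s : ℝ) : ℝ :=
  2 * cNs N s * (N * (Real.pi ^ ((N : ℝ) / 2) / Real.Gamma (N / 2 + 1)) / (2 * s))

lemma tendsto_cNs_div {N : ℕ} (hN : 1 ≤ N) :
    Tendsto (fun s : ℝ => (2 ^ (2 * s - 1) * Real.Gamma ((N + 2 * s) / 2) * (1 - s)) /
      (Real.pi ^ ((N : ℝ) / 2) * Real.Gamma (2 - s))) (𝓝 0)
      (𝓝 (Real.Gamma (N / 2) / (2 * Real.pi ^ ((N : ℝ) / 2)))) := by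
  have hN' : (0 : ℝ) < N := by exact_mod_cast hN
  have hΓ : ∀ t : ℝ, 0 < t → ContinuousAt Real.Gamma t := fun t ht =>
    (Real.differentiableAt_Gamma fun m => by
      have : (0 : ℝ) ≤ m := m.cast_nonneg
      linarith).continuousAt
  have h1 : ContinuousAt (fun s : ℝ => Real.Gamma ((N + 2 * s) / 2)) 0 :=
    ContinuousAt.comp (g := Real.Gamma) (hΓ _ (by simpa using hN')) (by fun_prop)
  have h2 : ContinuousAt (fun s : ℝ => Real.Gamma (2 - s)) 0 :=
    ContinuousAt.comp (g := Real.Gamma) (hΓ _ (by norm_num)) (by fun_prop)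
  have h3 : ContinuousAt (fun s : ℝ => (2 : ℝ) ^ (2 * s - 1)) 0 :=
    ContinuousAt.rpow (by fun_prop) (by fun_prop) (by norm_num)
  have hG2 : Real.Gamma 2 = 1 := by simp
  have hπ : Real.pi ^ ((N : ℝ) / 2) ≠ 0 := by positivity
  have h : ContinuousAt (fun s : ℝ => (2 ^ (2 * s - 1) * Real.Gamma ((N + 2 * s) / 2) * (1 - s)) /
      (Real.pi ^ ((N : ℝ) / 2) * Real.Gamma (2 - s))) 0 :=
    ((h3.mul h1).mul (by fun_prop)).div (h2.const_mul _) (by simp [hπ])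
  convert h.tendsto using 2
  simp only [mul_zero, add_zero, sub_zero, hG2, zero_sub, Real.rpow_neg_one, mul_one]
  field_simp

lemma cNs_eq (N : ℕ) (s : ℝ) :
    cNs N s = s * ((2 ^ (2 * s - 1) * Real.Gamma ((N + 2 * s) / 2) * (1 - s)) /
      (Real.pi ^ ((N : ℝ) / 2) * Real.Gamma (2 - s))) := by
  unfold cNs; ring

lemma tendsto_cNs {N : ℕ} (hN : 1 ≤ N) : Tendsto (cNs N) (𝓝[>] 0) (𝓝 0) := by
  have h := (tendsto_id (x := 𝓝 (0 : ℝ))).mul (tendsto_cNs_div hN)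
  rw [zero_mul] at h
  exact (h.congr fun s => (cNs_eq N s).symm).mono_left nhdsWithin_le_nhds

lemma tendsto_tailFactor {N : ℕ} (hN : 1 ≤ N) : Tendsto (tailFactor N) (𝓝[>] 0) (𝓝 1) := by
  have hN' : (0 : ℝ) < N := by exact_mod_cast hN
  have h := ((tendsto_cNs_div hN).mul_const
    (N * (Real.pi ^ ((N : ℝ) / 2) / Real.Gamma (N / 2 + 1)))).mono_left
    (nhdsWithin_le_nhds (s := Set.Ioi 0))
  have hlim : Real.Gamma (N / 2) / (2 * Real.pi ^ ((N : ℝ) / 2)) *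
      (N * (Real.pi ^ ((N : ℝ) / 2) / Real.Gamma (N / 2 + 1))) = 1 := by
    have hG : Real.Gamma ((N : ℝ) / 2) ≠ 0 := (Real.Gamma_pos_of_pos (by positivity)).ne'
    have hπ : Real.pi ^ ((N : ℝ) / 2) ≠ 0 := by positivity
    rw [Real.Gamma_add_one (by positivity)]
    field_simp
  rw [hlim] at h
  refine h.congr' ?_
  filter_upwards [self_mem_nhdsWithin] with s hs
  have hs : s ≠ 0 := ne_of_gt hs
  rw [tailFactor, cNs_eq]
  field_simp

lemma le_mul_decayWeight {N : ℕ} {R : ℝ} {x : EuclideanSpace ℝ (Fin N)}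
    (hx : ‖x‖ ≤ 1 + 2 * R) : 1 ≤ (2 * (1 + R)) ^ N * decayWeight N x := by
  rw [decayWeight, ← div_eq_mul_inv, one_le_div (by positivity)]
  exact pow_le_pow_left₀ (by positivity) (by linarith) N

lemma rpow_neg_le_mul_decayWeight {N : ℕ} {R s : ℝ} (hR : 0 ≤ R) (hs : 0 ≤ s)
    {x y : EuclideanSpace ℝ (Fin N)} (hy : 1 ≤ ‖y‖) (hxy : ‖x‖ ≤ R + ‖y‖) :
    ‖y‖ ^ (-((N : ℝ) + 2 * s)) ≤ (2 * (1 + R)) ^ N * decayWeight N x := by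
  have hy0 : 0 < ‖y‖ := by linarith
  calc ‖y‖ ^ (-((N : ℝ) + 2 * s)) ≤ ‖y‖ ^ (-(N : ℝ)) :=
        Real.rpow_le_rpow_of_exponent_le hy (by linarith)
    _ = 1 / ‖y‖ ^ N := by rw [Real.rpow_neg hy0.le, Real.rpow_natCast, one_div]
    _ ≤ (2 * (1 + R)) ^ N * decayWeight N x := by
        rw [decayWeight, ← div_eq_mul_inv, div_le_div_iff₀ (by positivity) (by positivity),
          ← mul_pow, one_mul]
        exact pow_le_pow_left₀ (by positivity) (by nlinarith) N

section PointwiseBound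

variable {N : ℕ} {v : EuclideanSpace ℝ (Fin N) → ℝ} {R L s : ℝ}

lemma abs_integrand_sub_tail_le (hR : 0 ≤ R) (hL : 0 ≤ L) (hs0 : 0 < s) (hs : s ≤ 1 / 4)
    (hsupp : ∀ z, R < ‖z‖ → v z = 0) (hlip : ∀ z w, |v z - v w| ≤ L * ‖z - w‖)
    (x y : EuclideanSpace ℝ (Fin N)) :
    |(2 * v x - v (x + y) - v (x - y)) / ‖y‖ ^ ((N : ℝ) + 2 * s) - 2 * v x * kernelTail N s ‖y‖| ≤
      (2 * (1 + R)) ^ N * decayWeight N x *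
        (2 * L * kernelNear N ‖y‖ + |v (x + y)| + |v (x - y)|) := by
  set A := (2 * (1 + R)) ^ N * decayWeight N x with hA
  have hA0 : 0 ≤ A := mul_nonneg (by positivity) (decayWeight_nonneg N x)
  rcases le_or_gt ‖y‖ 1 with hy | hy
  · have hT : kernelTail N s ‖y‖ = 0 := by simp [kernelTail, hy]
    have hI : kernelNear N ‖y‖ = ‖y‖ ^ (1 / 2 - (N : ℝ)) := by simp [kernelNear, hy]
    have hI0 : 0 ≤ kernelNear N ‖y‖ := by rw [hI]; positivity
    rw [hT, mul_zero, sub_zero]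
    suffices h : |(2 * v x - v (x + y) - v (x - y)) / ‖y‖ ^ ((N : ℝ) + 2 * s)| ≤
        A * (2 * L * kernelNear N ‖y‖) by
      refine h.trans (mul_le_mul_of_nonneg_left ?_ hA0)
      linarith [abs_nonneg (v (x + y)), abs_nonneg (v (x - y))]
    rcases eq_or_ne y 0 with rfl | hy0
    · have : (2 * v x - v (x + 0) - v (x - 0)) = 0 := by
        rw [add_zero, sub_zero]; ring
      rw [this, zero_div, abs_zero]
      positivity
    have hyp : 0 < ‖y‖ := norm_pos_iff.2 hy0
    rcases le_or_gt ‖x‖ (1 + 2 * R) with hx | hx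
    · have hA1 : 1 ≤ A := le_mul_decayWeight hx
      have hnum : |2 * v x - v (x + y) - v (x - y)| ≤ 2 * L * ‖y‖ := by
        have h1 := hlip x (x + y)
        have h2 := hlip x (x - y)
        rw [sub_add_cancel_left, norm_neg] at h1
        rw [sub_sub_cancel] at h2
        calc |2 * v x - v (x + y) - v (x - y)|
            = |(v x - v (x + y)) + (v x - v (x - y))| := by congr 1; ring
          _ ≤ |v x - v (x + y)| + |v x - v (x - y)| := abs_add_le _ _
          _ ≤ 2 * L * ‖y‖ := by linarith
      have hker : ‖y‖ / ‖y‖ ^ ((N : ℝ) + 2 * s) ≤ kernelNear N ‖y‖ := by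
        have h := Real.rpow_sub hyp 1 ((N : ℝ) + 2 * s)
        rw [Real.rpow_one] at h
        rw [hI, ← h]
        exact Real.rpow_le_rpow_of_exponent_ge hyp hy (by linarith)
      rw [abs_div, abs_of_nonneg (Real.rpow_nonneg hyp.le ((N : ℝ) + 2 * s))]
      calc |2 * v x - v (x + y) - v (x - y)| / ‖y‖ ^ ((N : ℝ) + 2 * s)
          ≤ 2 * L * ‖y‖ / ‖y‖ ^ ((N : ℝ) + 2 * s) := by gcongr
        _ = 2 * L * (‖y‖ / ‖y‖ ^ ((N : ℝ) + 2 * s)) := by ring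
        _ ≤ 2 * L * kernelNear N ‖y‖ := by gcongr
        _ ≤ A * (2 * L * kernelNear N ‖y‖) := le_mul_of_one_le_left (by positivity) hA1
    · have h1 : R < ‖x + y‖ := by
        have := norm_sub_le (x + y) y
        rw [add_sub_cancel_right] at this
        linarith
      have h2 : R < ‖x - y‖ := by
        have := norm_add_le (x - y) y
        rw [sub_add_cancel] at this
        linarith
      rw [hsupp x (by linarith), hsupp _ h1, hsupp _ h2]
      simp only [mul_zero, sub_zero, zero_div, abs_zero]
      positivity
  · have hy0 : 0 < ‖y‖ := by linarith
    have hT : kernelTail N s ‖y‖ = ‖y‖ ^ (-((N : ℝ) + 2 * s)) := by simp [kernelTail, hy]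
    have hI : kernelNear N ‖y‖ = 0 := by simp [kernelNear, hy]
    have hp : 0 ≤ ‖y‖ ^ (-((N : ℝ) + 2 * s)) := by positivity
    have key : ∀ z, ‖x‖ ≤ ‖z‖ + ‖y‖ → |v z| * ‖y‖ ^ (-((N : ℝ) + 2 * s)) ≤ A * |v z| := by
      intro z hz
      rcases le_or_gt ‖z‖ R with h | h
      · rw [mul_comm]
        exact mul_le_mul_of_nonneg_right
          (rpow_neg_le_mul_decayWeight hR hs0.le hy.le (by linarith)) (abs_nonneg _)
      · simp [hsupp z h]
    have h1 := key (x + y) (by simpa using norm_sub_le (x + y) y)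
    have h2 := key (x - y) (by simpa using norm_add_le (x - y) y)
    rw [hT, hI, div_eq_mul_inv, ← Real.rpow_neg hy0.le]
    calc |(2 * v x - v (x + y) - v (x - y)) * ‖y‖ ^ (-((N : ℝ) + 2 * s)) -
          2 * v x * ‖y‖ ^ (-((N : ℝ) + 2 * s))|
        = |v (x + y) + v (x - y)| * ‖y‖ ^ (-((N : ℝ) + 2 * s)) := by
          rw [← abs_of_nonneg hp, ← abs_mul, ← abs_neg, abs_of_nonneg hp]; congr 1; ring
      _ ≤ (|v (x + y)| + |v (x - y)|) * ‖y‖ ^ (-((N : ℝ) + 2 * s)) := by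
          gcongr; exact abs_add_le _ _
      _ ≤ A * (2 * L * 0 + |v (x + y)| + |v (x - y)|) := by linarith

lemma abs_fracLap0_sub_le (hN : 1 ≤ N) (hR : 0 ≤ R) (hL : 0 ≤ L) (hs0 : 0 < s) (hs : s ≤ 1 / 4)
    (hsupp : ∀ z, R < ‖z‖ → v z = 0) (hlip : ∀ z w, |v z - v w| ≤ L * ‖z - w‖)
    (hcont : Continuous v) (hint : Integrable v) {M : ℝ} (hM : ∀ z, |v z| ≤ M)
    (x : EuclideanSpace ℝ (Fin N)) :
    |fracLap0 N s v x - v x| ≤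
      (|cNs N s| * (2 * L * (∫ y : EuclideanSpace ℝ (Fin N), kernelNear N ‖y‖) +
          2 * ∫ y, |v y|) + |tailFactor N s - 1| * M) * (2 * (1 + R)) ^ N * decayWeight N x := by
  set A := (2 * (1 + R)) ^ N * decayWeight N x with hA
  have hA0 : 0 ≤ A := mul_nonneg (by positivity) (decayWeight_nonneg N x)
  set F : EuclideanSpace ℝ (Fin N) → ℝ := fun y =>
    (2 * v x - v (x + y) - v (x - y)) / ‖y‖ ^ ((N : ℝ) + 2 * s) with hF
  set T : EuclideanSpace ℝ (Fin N) → ℝ := fun y => 2 * v x * kernelTail N s ‖y‖ with hT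
  have hTint : Integrable T := (integrable_kernelTail hN hs0).const_mul _
  have hadd : Integrable fun y => |v (x + y)| := (hint.comp_add_left x).abs
  have hsub : Integrable fun y => |v (x - y)| := (hint.comp_sub_left x).abs
  have hnear := (integrable_kernelNear hN).const_mul (2 * L)
  have hnear_add : Integrable fun y : EuclideanSpace ℝ (Fin N) =>
      2 * L * kernelNear N ‖y‖ + |v (x + y)| := hnear.add hadd
  have hBint : Integrable fun y : EuclideanSpace ℝ (Fin N) =>
      A * (2 * L * kernelNear N ‖y‖ + |v (x + y)| + |v (x - y)|) :=
    (hnear_add.add hsub).const_mul A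
  have hle : ∀ y, ‖F y - T y‖ ≤ A * (2 * L * kernelNear N ‖y‖ + |v (x + y)| + |v (x - y)|) :=
    abs_integrand_sub_tail_le hR hL hs0 hs hsupp hlip x
  have hFmeas : AEStronglyMeasurable F volume := by
    apply Measurable.aestronglyMeasurable
    have := hcont.measurable
    fun_prop
  have hG : Integrable fun y => F y - T y :=
    hBint.mono' (hFmeas.sub hTint.1) (Eventually.of_forall hle)
  have hGle : |∫ y, (F y - T y)| ≤
      A * (2 * L * (∫ y : EuclideanSpace ℝ (Fin N), kernelNear N ‖y‖) + 2 * ∫ y, |v y|) := by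
    refine (norm_integral_le_of_norm_le hBint (Eventually.of_forall hle)).trans_eq ?_
    rw [integral_const_mul, integral_add hnear_add hsub, integral_add hnear hadd,
      integral_const_mul, integral_add_left_eq_self (fun z => |v z|),
      integral_sub_left_eq_self (fun z => |v z|)]
    ring
  have hFint : ∫ y, F y = (∫ y, (F y - T y)) + ∫ y, T y := by
    rw [← integral_add hG hTint]
    simp
  have hTval : cNs N s * ∫ y, T y = tailFactor N s * v x := by
    rw [hT, integral_const_mul, integral_kernelTail hN hs0, tailFactor]
    ring
  have hvx : |v x| ≤ M * A := by
    rcases le_or_gt ‖x‖ R with h | h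
    · exact (hM x).trans (le_mul_of_one_le_right ((abs_nonneg _).trans (hM x))
        (le_mul_decayWeight (by linarith)))
    · rw [hsupp x h, abs_zero]
      exact mul_nonneg ((abs_nonneg _).trans (hM x)) hA0
  rw [fracLap0, if_neg hs0.ne', mul_assoc _ ((2 * (1 + R)) ^ N), ← hA]
  change |cNs N s * (∫ y, F y) - v x| ≤ _
  rw [hFint, mul_add, hTval]
  calc |cNs N s * (∫ y, (F y - T y)) + tailFactor N s * v x - v x|
      = |cNs N s * (∫ y, (F y - T y)) + (tailFactor N s - 1) * v x| := by congr 1; ring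
    _ ≤ |cNs N s| * |∫ y, (F y - T y)| + |tailFactor N s - 1| * |v x| := by
        rw [← abs_mul, ← abs_mul]; exact abs_add_le _ _
    _ ≤ |cNs N s| * (A * (2 * L * (∫ y : EuclideanSpace ℝ (Fin N), kernelNear N ‖y‖) +
          2 * ∫ y, |v y|)) + |tailFactor N s - 1| * (M * A) := by gcongr
    _ = _ := by ring

end PointwiseBound

lemma tendsto_eLpNorm_fracLap0_sub {N : ℕ} (hN : 1 ≤ N) {v : EuclideanSpace ℝ (Fin N) → ℝ}
    (hv : ContDiff ℝ 1 v) (hcs : HasCompactSupport v) :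
    Tendsto (fun s => (eLpNorm (fun x => fracLap0 N s v x - v x) 2 volume).toReal)
      (𝓝[>] 0) (𝓝 0) := by
  obtain ⟨L, hL⟩ := hv.lipschitzWith_of_hasCompactSupport hcs one_ne_zero
  obtain ⟨M, hM⟩ := hcs.exists_bound_of_continuous hv.continuous
  obtain ⟨R, hR0, hR⟩ := hcs.isCompact.isBounded.exists_pos_norm_le
  have hsupp : ∀ z, R < ‖z‖ → v z = 0 := fun z hz =>
    image_eq_zero_of_notMem_tsupport fun h => hz.not_ge (hR z h)
  have hlip : ∀ z w, |v z - v w| ≤ L * ‖z - w‖ := fun z w => by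
    simpa [Real.dist_eq, dist_eq_norm] using hL.dist_le_mul z w
  have hint : Integrable v := hv.continuous.integrable_of_hasCompactSupport hcs
  set δ : ℝ → ℝ := fun s =>
    (|cNs N s| * (2 * L * (∫ y : EuclideanSpace ℝ (Fin N), kernelNear N ‖y‖) +
      2 * ∫ y, |v y|) + |tailFactor N s - 1| * M) * (2 * (1 + R)) ^ N with hδ
  have hδlim : Tendsto δ (𝓝[>] 0) (𝓝 0) := by
    have h1 := (tendsto_cNs hN).abs.mul_const
      (2 * L * (∫ y : EuclideanSpace ℝ (Fin N), kernelNear N ‖y‖) + 2 * ∫ y, |v y|)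
    have h2 := ((tendsto_tailFactor hN).sub_const 1).abs.mul_const M
    simpa using (h1.add h2).mul_const ((2 * (1 + R)) ^ N)
  have hw : eLpNorm (decayWeight N) 2 volume ≠ ⊤ := (memLp_decayWeight hN).2.ne
  have hlim : Tendsto (fun s => |δ s| * (eLpNorm (decayWeight N) 2 volume).toReal)
      (𝓝[>] 0) (𝓝 0) := by
    simpa using hδlim.abs.mul_const (eLpNorm (decayWeight N) 2 volume).toReal
  refine squeeze_zero' (Eventually.of_forall fun _ => ENNReal.toReal_nonneg) ?_ hlim
  filter_upwards [Ioc_mem_nhdsGT (show (0 : ℝ) < 1 / 4 by norm_num)] with s hs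
  have h : eLpNorm (fun x => fracLap0 N s v x - v x) 2 volume ≤
      ENNReal.ofReal |δ s| * eLpNorm (decayWeight N) 2 volume := by
    refine eLpNorm_le_mul_eLpNorm_of_ae_le_mul (Eventually.of_forall fun x => ?_) 2
    rw [Real.norm_of_nonneg (decayWeight_nonneg N x)]
    exact (abs_fracLap0_sub_le hN hR0.le L.2 hs.1 hs.2 hsupp hlip hv.continuous hint hM x).trans
      (mul_le_mul_of_nonneg_right (le_abs_self _) (decayWeight_nonneg N x))
  calc (eLpNorm (fun x => fracLap0 N s v x - v x) 2 volume).toReal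
      ≤ (ENNReal.ofReal |δ s| * eLpNorm (decayWeight N) 2 volume).toReal :=
        ENNReal.toReal_mono (ENNReal.mul_ne_top ENNReal.ofReal_ne_top hw) h
    _ = _ := by rw [ENNReal.toReal_mul, ENNReal.toReal_ofReal (abs_nonneg _)]

theorem stmt11 (N : ℕ) (hN : 1 ≤ N) (v : EuclideanSpace ℝ (Fin N) → ℝ)
    (hv : ContDiff ℝ (⊤ : ℕ∞) v) (hcs : HasCompactSupport v)
    (ε : ℕ → ℝ) (hεmem : ∀ n, ε n ∈ Set.Ioc (0 : ℝ) 1) (hεlim : Tendsto ε atTop (nhds 0))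
    (μm : ℕ → Measure ℝ) [∀ n, IsProbabilityMeasure (μm n)]
    (hμmsupp : ∀ n, μm n (Set.Icc 0 (ε n))ᶜ = 0) :
    Tendsto (fun n => ∫ s in Set.Icc (0 : ℝ) (ε n),
        (eLpNorm (fun x => fracLap0 N s v x - v x) 2 volume).toReal ∂(μm n))
      atTop (nhds 0) := by
  have hzero : (eLpNorm (fun x => fracLap0 N 0 v x - v x) 2 volume).toReal = 0 := by
    simp [fracLap0]
  rw [Metric.tendsto_atTop]
  intro η hη
  have hsmall := (tendsto_eLpNorm_fracLap0_sub hN (hv.of_le (by exact_mod_cast le_top)) hcs).eventually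
    (gt_mem_nhds (half_pos hη))
  obtain ⟨t, ht, hsub⟩ := mem_nhdsGT_iff_exists_Ioo_subset.1 hsmall
  obtain ⟨n₀, hn₀⟩ := eventually_atTop.1 (hεlim.eventually (gt_mem_nhds ht))
  refine ⟨n₀, fun n hn => ?_⟩
  rw [dist_zero_right]
  have hbound : ∀ s ∈ Set.Icc (0 : ℝ) (ε n),
      ‖(eLpNorm (fun x => fracLap0 N s v x - v x) 2 volume).toReal‖ ≤ η / 2 := by
    intro s hs
    rw [Real.norm_of_nonneg ENNReal.toReal_nonneg]
    rcases hs.1.eq_or_lt with rfl | hs0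
    · rw [hzero]; exact (half_pos hη).le
    · exact (hsub ⟨hs0, hs.2.trans_lt (hn₀ n hn)⟩ : _ < _).le
  have h := norm_setIntegral_le_of_norm_le_const (measure_lt_top (μm n) _) hbound
  have h1 : (μm n).real (Set.Icc 0 (ε n)) ≤ 1 := measureReal_le_one
  have h0 : 0 ≤ (μm n).real (Set.Icc 0 (ε n)) := measureReal_nonneg
  nlinarith
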